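/- Let μ = (μ_1, …, μ_r) be a 2-regular partition (μ_1 > ⋯ > μ_r > 0) which is a 4-core, i.e. no hook length of [μ] is divisible by 4. Then the difference μ_i − μ_{i+1} is odd for every 1 ≤ i ≤ r−1; in fact μ_i − μ_{i+1} ∈ {1,3} for every 1 ≤ i ≤ r−1. -/

import Mathlib

/-- The conjugate partition value `μ'_j = #{i : 1 ≤ i ≤ r, μ_i ≥ j}`,
for a partition `μ` supported on indices `1, …, r`. -/
def muConj (r : ℕ) (μ : ℕ → ℕ) (j : ℕ) : ℕ :=
  ((Finset.Icc 1 r).filter (fun i => j ≤ μ i)).card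

/-- The hook length `h_{i,j} = (μ_i − j) + (μ'_j − i) + 1` of the cell `(i,j)`. -/
def muHook (r : ℕ) (μ : ℕ → ℕ) (i j : ℕ) : ℕ :=
  (μ i - j) + (muConj r μ j - i) + 1

theorem muConj_eq_of_step (r : ℕ) (μ : ℕ → ℕ)
    (hdec : ∀ i j, 1 ≤ i → i ≤ j → j ≤ r → μ j ≤ μ i)
    (k j : ℕ) (hkr : k ≤ r) (h1 : j ≤ μ k) (h2 : μ (k + 1) < j) :
    muConj r μ j = k := by
  have h : (Finset.Icc 1 r).filter (fun i => j ≤ μ i) = Finset.Icc 1 k := by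
    ext x
    simp only [Finset.mem_filter, Finset.mem_Icc]
    constructor
    · rintro ⟨⟨hx1, hxr⟩, hx⟩
      refine ⟨hx1, ?_⟩
      by_contra hlt
      have := hdec (k + 1) x (by omega) (by omega) hxr
      omega
    · rintro ⟨hx1, hxk⟩
      have := hdec x k hx1 hxk hkr
      omega
  unfold muConj
  rw [h]
  simp

/-- If `μ` is a 2-regular 4-core partition then every difference `μ_i − μ_{i+1}`
(for `1 ≤ i ≤ r−1`) is odd; in fact it lies in `{1,3}`. -/
theorem two_regular_four_core_differences_odd
    (r : ℕ) (μ : ℕ → ℕ) (hr : 1 ≤ r)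
    (hdec : ∀ i j, 1 ≤ i → i ≤ j → j ≤ r → μ j ≤ μ i)
    (hpos : ∀ i, 1 ≤ i → i ≤ r → 0 < μ i)
    (hzero : ∀ i, r < i → μ i = 0)
    (hreg : ∀ i, 1 ≤ i → i < r → μ (i + 1) < μ i)
    (hcore : ∀ i j, 1 ≤ i → i ≤ r → 1 ≤ j → j ≤ μ i → ¬ (4 ∣ muHook r μ i j)) :
    (∀ i, 1 ≤ i → i ≤ r - 1 → Odd (μ i - μ (i + 1))) ∧
    (∀ i, 1 ≤ i → i ≤ r - 1 → μ i - μ (i + 1) = 1 ∨ μ i - μ (i + 1) = 3) := by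
  have key : ∀ i, 1 ≤ i → i ≤ r - 1 → μ i - μ (i + 1) = 1 ∨ μ i - μ (i + 1) = 3 := by
    intro i h1 h2
    have hlt := hreg i h1 (by omega)
    have hp := hpos (i + 1) (by omega) (by omega)
    have hbig : ¬ (μ (i + 1) + 4 ≤ μ i) := by
      intro hd
      apply hcore i (μ i - 3) h1 (by omega) (by omega) (by omega)
      have hc := muConj_eq_of_step r μ hdec i (μ i - 3) (by omega) (by omega) (by omega)
      have : muHook r μ i (μ i - 3) = 4 := by
        unfold muHook
        omega
      rw [this]
    have htwo : ¬ (μ i = μ (i + 1) + 2) := by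
      intro hd
      apply hcore i (μ (i + 1)) h1 (by omega) (by omega) (by omega)
      have hn : μ (i + 1 + 1) < μ (i + 1) := by
        by_cases hi : i + 1 < r
        · exact hreg (i + 1) (by omega) hi
        · rw [hzero (i + 1 + 1) (by omega)]
          exact hp
      have hc := muConj_eq_of_step r μ hdec (i + 1) (μ (i + 1)) (by omega) le_rfl hn
      have : muHook r μ i (μ (i + 1)) = 4 := by
        unfold muHook
        omega
      rw [this]
    omega
  refine ⟨?_, key⟩
  intro i h1 h2
  rcases key i h1 h2 with h | h <;> rw [h] <;> decide
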